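/- arXiv:1911.11045 — 2 statements merged into one kernel-verified Lean document; each statement's English description precedes it below -/
import Mathlib

section
/- Let S be the set of rows of λ met by the evacuation route of some 1-path removing X = {x_1 = [b_1](1, w_{b_1})} (so S contains the bottom row of block b_1 and, within each block, the rows of S form an initial segment from the bottom of the block). Then the number of 1-paths removing X whose evacuation route meets exactly the rows in S equals ∏_{r ∈ S} λ_r, the product of the lengths of those rows (rows indexed from the top, λ_r being the number of boxes in row r). -/
/-!
Formalization of definitions from "Pieri inclusions" (arXiv:1911.11045).

Cells `(r, j)` have row index `r` (counted from the *top*, `0`-based; so a cell is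
geometrically *lower* than another iff its row index is *larger*) and column index `j`
(`0`-based).  A shape is a finite set `K` of cells; in the intended applications `K` is the
set of cells of a Young diagram (possibly with some boxes removed).  Blocks of a partition
are recovered as the (automatically contiguous) groups of rows of equal width.
-/

open scoped TensorProduct Classical

noncomputable section

namespace PieriPaper

/-! ### Shapes, tableaux, Garnir relations -/

/-- A cell `(r, j)`: row `r` (from the top, `0`-based), column `j` (`0`-based). -/
abbrev Cell : Type := ℕ × ℕ

/-- The boxes of the shape given by a finite set `K` of cells. -/
abbrev BoxOf (K : Finset Cell) : Type := {c : Cell // c ∈ K}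

/-- Tableaux of shape `K` with entries in `Fin n` (representing `{1, …, n}`). -/
abbrev Tab (K : Finset Cell) (n : ℕ) : Type := BoxOf K → Fin n

/-- `ℱ_{K,n}`: the free complex vector space on the set of tableaux of shape `K`. -/
abbrev FreeT (K : Finset Cell) (n : ℕ) : Type := Tab K n →₀ ℂ

/-- The number of boxes of `K` in row `r` (the width of row `r`). -/
def rowWidth (K : Finset Cell) (r : ℕ) : ℕ := (K.filter fun c => c.1 = r).card

/-- The set of indices of nonempty rows of `K`. -/
def rowsOf (K : Finset Cell) : Finset ℕ := K.image Prod.fst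

/-- The set of boxes of `K` lying in row `r`. -/
def rowBoxes (K : Finset Cell) (r : ℕ) : Finset (BoxOf K) :=
  Finset.univ.filter fun b => b.val.1 = r

/-- Action of a permutation of the boxes on tableaux: `(σ · T) x = T (σ⁻¹ x)`. -/
def permAct {K : Finset Cell} {n : ℕ} (σ : Equiv.Perm (BoxOf K)) (T : Tab K n) : Tab K n :=
  fun x => T (σ⁻¹ x)

/-- The linear extension of the permutation action to `ℱ_{K,n}`. -/
def permL (K : Finset Cell) (n : ℕ) (σ : Equiv.Perm (BoxOf K)) : FreeT K n →ₗ[ℂ] FreeT K n :=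
  Finsupp.lift (FreeT K n) ℂ (Tab K n) fun T => Finsupp.single (permAct σ T) 1

/-- `w_A`: the maximum width of a row meeting `A`. -/
def wA (K : Finset Cell) (A : Finset (BoxOf K)) : ℕ := A.sup fun x => rowWidth K x.val.1

/-- `𝔖_A`: permutations preserving `A` and fixing every box outside `A`. -/
def SA {K : Finset Cell} (A : Finset (BoxOf K)) : Finset (Equiv.Perm (BoxOf K)) :=
  Finset.univ.filter fun σ => ∀ x, x ∉ A → σ x = x

/-- The Garnir operator `G_A` applied to a tableau `T`. -/
def garnir {K : Finset Cell} {n : ℕ} (A : Finset (BoxOf K)) (T : Tab K n) : FreeT K n :=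
  ∑ σ ∈ SA A, Finsupp.single (permAct σ T) 1

/-- The linear extension of the Garnir operator `G_A` to `ℱ_{K,n}`. -/
def garnirL (K : Finset Cell) (n : ℕ) (A : Finset (BoxOf K)) : FreeT K n →ₗ[ℂ] FreeT K n :=
  Finsupp.lift (FreeT K n) ℂ (Tab K n) fun T => garnir A T

/-- Two tableaux agree up to permutations of the entries within rows. -/
def RowEquiv {K : Finset Cell} {n : ℕ} (T₁ T₂ : Tab K n) : Prop :=
  ∃ σ : Equiv.Perm (BoxOf K), (∀ x, (σ x).val.1 = x.val.1) ∧ T₂ = permAct σ T₁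

/-- The span of the row-permutation differences `T₁ - T₂`. -/
def rowSpan (K : Finset Cell) (n : ℕ) : Submodule ℂ (FreeT K n) :=
  Submodule.span ℂ
    {z | ∃ T₁ T₂ : Tab K n, RowEquiv T₁ T₂ ∧ z = Finsupp.single T₁ 1 - Finsupp.single T₂ 1}

/-- `R_{K,n}`: the subspace of relations, spanned by row-permutation differences and
Garnir elements `G_A T` for `|A| > w_A`. -/
def Rmod (K : Finset Cell) (n : ℕ) : Submodule ℂ (FreeT K n) :=
  Submodule.span ℂ
    ({z | ∃ T₁ T₂ : Tab K n, RowEquiv T₁ T₂ ∧ z = Finsupp.single T₁ 1 - Finsupp.single T₂ 1} ∪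
      {z | ∃ (A : Finset (BoxOf K)) (T : Tab K n), wA K A < A.card ∧ z = garnir A T})

/-- The standard basis vector `e_i` of `V = ℂⁿ`. -/
def stdv (n : ℕ) (i : Fin n) : Fin n → ℂ := Pi.single i 1

/-- The action of a matrix `g` on `ℱ_{K,n}`:
`g · T = ∑_{T'} (∏_x g_{T'(x), T(x)}) T'`. -/
def glAct (K : Finset Cell) (n : ℕ) (g : Matrix (Fin n) (Fin n) ℂ) :
    FreeT K n →ₗ[ℂ] FreeT K n :=
  Finsupp.lift (FreeT K n) ℂ (Tab K n) fun T =>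
    ∑ T' : Tab K n, (∏ x : BoxOf K, g (T' x) (T x)) • Finsupp.single T' (1 : ℂ)

/-! ### Removal sets -/

/-- A removal set of `m` boxes `x_1 < x_2 < ⋯ < x_m` for the shape `K`: each `x_k` is the
rightmost box of its row, `x_1` is geometrically lowest (largest top-row-index), … , `x_m`
highest, and removing all of them leaves a Young-diagram shape (a lower set). -/
structure RemovalOn (K : Finset Cell) (m : ℕ) where
  box : Fin m → Cell
  mem : ∀ k, box k ∈ K
  lastCol : ∀ k, (box k).2 + 1 = rowWidth K (box k).1
  rows_anti : StrictAnti fun k => (box k).1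
  lower : IsLowerSet (↑(K.filter fun c => ∀ i : Fin m, (i : ℕ) < m → c ≠ box i) : Set Cell)

/-- The shape obtained from `K` by removing the first `k` boxes `x_1, …, x_k` of `X`. -/
def keptUpTo {K : Finset Cell} {m : ℕ} (X : RemovalOn K m) (k : ℕ) : Finset Cell :=
  K.filter fun c => ∀ i : Fin m, (i : ℕ) < k → c ≠ X.box i

/-- `λ ∖ X`: the shape obtained by removing all the boxes of `X`. -/
abbrev RemovalOn.kept {K : Finset Cell} {m : ℕ} (X : RemovalOn K m) : Finset Cell := keptUpTo X m

lemma keptUpTo_subset {K : Finset Cell} {m : ℕ} (X : RemovalOn K m) (k : ℕ) :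
    keptUpTo X k ⊆ K := Finset.filter_subset _ _

lemma kept_subset {K : Finset Cell} {m : ℕ} (X : RemovalOn K m) : X.kept ⊆ K :=
  Finset.filter_subset _ _

lemma keptUpTo_zero {K : Finset Cell} {m : ℕ} (X : RemovalOn K m) : K = keptUpTo X 0 :=
  (Finset.filter_true_of_mem fun _ _ => fun _ hi => absurd hi (Nat.not_lt_zero _)).symm

/-! ### Paths -/

/-- The boxes of `K` together with `m` extra boxes `y_1, …, y_m` attached above the shape. -/
abbrev PB (K : Finset Cell) (m : ℕ) : Type := BoxOf K ⊕ Fin m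

/-- Comparison value of a box: a box is geometrically weakly lower than another iff its
`lowVal` is larger.  The extra boxes `y_1, y_2, …` get values `-1, -2, …` (above the shape,
with `y_{i+1}` above `y_i`). -/
def lowVal {K : Finset Cell} {m : ℕ} : PB K m → ℤ
  | Sum.inl b => (b.val.1 : ℤ)
  | Sum.inr i => -1 - (i : ℤ)

/-- An evacuation route starting at the block whose bottom row is `r₁`: it contains a box in
row `r₁`, at most one box per row, and skips no row within a block (blocks being the groups
of rows of equal width). -/
structure IsEvacRoute (K : Finset Cell) (r₁ : ℕ) (R : Finset (BoxOf K)) : Prop where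
  start : ∃ b ∈ R, b.val.1 = r₁
  one_per_row : ∀ b ∈ R, ∀ b' ∈ R, b.val.1 = b'.val.1 → b = b'
  no_skip : ∀ b ∈ R, ∀ r' : ℕ, b.val.1 < r' → rowWidth K r' = rowWidth K b.val.1 →
    ∃ b' ∈ R, b'.val.1 = r'

/-- The orbit `R_i` of `x_i` under iteration of `P`. -/
def orb {K : Finset Cell} {m : ℕ} (X : RemovalOn K m) (P : PB K m → PB K m) (i : Fin m) :
    Set (PB K m) := {z | ∃ j : ℕ, P^[j] (Sum.inl ⟨X.box i, X.mem i⟩) = z}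

/-- The orbit of `x_i` meets the block (of the original shape) of width `w`. -/
def meetsBlock {K : Finset Cell} {m : ℕ} (X : RemovalOn K m) (P : PB K m → PB K m)
    (i : Fin m) (w : ℕ) : Prop :=
  ∃ c : BoxOf K, Sum.inl c ∈ orb X P i ∧ rowWidth K c.val.1 = w

/-- `P` together with the evacuation route `R` is an `m`-path removing `X`:
see Section 4.2 of the paper. -/
structure IsMPath {K : Finset Cell} {m : ℕ} [NeZero m] (X : RemovalOn K m)
    (P : PB K m → PB K m) (R : Finset (BoxOf K)) : Prop where
  /-- the route starts at the block of `x₁` -/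
  route : IsEvacRoute K (X.box 0).1 R
  /-- `P` is geometrically (weakly) increasing -/
  mono : ∀ z, lowVal (P z) ≤ lowVal z
  /-- and strictly increasing on the route -/
  strict_on_route : ∀ b ∈ R, lowVal (P (Sum.inl b)) < (b.val.1 : ℤ)
  /-- `y_i` belongs to the orbit of `x_i` -/
  y_mem : ∀ i, Sum.inr i ∈ orb X P i
  /-- `R ∪ X ∪ Y` is the union of the orbits -/
  orb_union : (⋃ i, orb X P i) =
    {z : PB K m | (∃ b ∈ R, z = Sum.inl b) ∨ (∃ i, z = Sum.inl ⟨X.box i, X.mem i⟩) ∨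
      ∃ i, z = Sum.inr i}
  /-- and the union is disjoint -/
  orb_disjoint : ∀ i j, i ≠ j → Disjoint (orb X P i) (orb X P j)
  /-- if `k` distinct orbits meet a block, then (up to relabeling) the `j`-th of them meets
  the `j`-th row from the bottom of the block, for `j = 0, …, k-1` -/
  interlace : ∀ w : ℕ, 0 < w → ∃ g : Fin m → ℕ,
    Set.InjOn g {i | meetsBlock X P i w} ∧
    ∀ i, meetsBlock X P i w →
      g i < Set.ncard {j | meetsBlock X P j w} ∧
      ∃ c : BoxOf K, Sum.inl c ∈ orb X P i ∧ rowWidth K c.val.1 = w ∧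
        ((rowsOf K).filter fun r => c.val.1 < r ∧ rowWidth K r = w).card = g i
  /-- `P` preserves row order within blocks on the route -/
  row_order : ∀ b ∈ R, ∀ b' ∈ R, ∀ c c' : BoxOf K,
    rowWidth K b.val.1 = rowWidth K b'.val.1 → b'.val.1 < b.val.1 →
    P (Sum.inl b) = Sum.inl c → P (Sum.inl b') = Sum.inl c' →
    rowWidth K c.val.1 = rowWidth K b.val.1 → rowWidth K c'.val.1 = rowWidth K b.val.1 →
    c'.val.1 < c.val.1
  /-- `P` fixes the extra boxes -/
  fix_y : ∀ i, P (Sum.inr i) = Sum.inr i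
  /-- `P` fixes every box outside `R ∪ X` -/
  fix_out : ∀ b : BoxOf K, b ∉ R → (∀ i, b.val ≠ X.box i) → P (Sum.inl b) = Sum.inl b
  /-- `P(R ∪ X) = (R ∖ X) ∪ Y` -/
  image_route : (fun b : BoxOf K => P (Sum.inl b)) ''
      {b : BoxOf K | b ∈ R ∨ ∃ i, b.val = X.box i} =
    (Sum.inl '' {b : BoxOf K | b ∈ R ∧ ∀ i, b.val ≠ X.box i}) ∪
      Set.range (Sum.inr : Fin m → PB K m)

/-- The type of `m`-paths removing `X` (a path is the pair of the map and its route). -/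
def MPath {K : Finset Cell} {m : ℕ} [NeZero m] (X : RemovalOn K m) : Type :=
  {PR : (PB K m → PB K m) × Finset (BoxOf K) // IsMPath X PR.1 PR.2}

instance {K : Finset Cell} {m : ℕ} [NeZero m] (X : RemovalOn K m) : Fintype (MPath X) := by
  unfold MPath; infer_instance

/-- The underlying map of boxes of a path. -/
def MPath.map {K : Finset Cell} {m : ℕ} [NeZero m] {X : RemovalOn K m} (P : MPath X) :
    PB K m → PB K m := P.val.1

/-- The evacuation route of a path. -/
def MPath.route {K : Finset Cell} {m : ℕ} [NeZero m] {X : RemovalOn K m} (P : MPath X) :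
    Finset (BoxOf K) := P.val.2

/-- `P⁻¹ z`: the (unique) box of the original shape whose image under `P` is `z`. -/
def pinv {K : Finset Cell} {m : ℕ} [NeZero m] (X : RemovalOn K m) (P : PB K m → PB K m)
    (z : PB K m) : BoxOf K :=
  @Function.invFun (BoxOf K) (PB K m) ⟨⟨X.box 0, X.mem 0⟩⟩ (fun b => P (Sum.inl b)) z

/-- `α_i^P`: the entry of `T` in the box `P⁻¹ (y_i)`. -/
def alphaP {K : Finset Cell} {m n : ℕ} [NeZero m] (X : RemovalOn K m) (T : Tab K n)
    (P : PB K m → PB K m) (i : Fin m) : Fin n := T (pinv X P (Sum.inr i))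

/-- `T_P`: the tableau of shape `λ ∖ X` with `(T_P)_z = T_{P⁻¹ z}`. -/
def TP {K : Finset Cell} {m n : ℕ} [NeZero m] (X : RemovalOn K m) (T : Tab K n)
    (P : PB K m → PB K m) : Tab X.kept n :=
  fun z => T (pinv X P (Sum.inl ⟨z.val, kept_subset X z.2⟩))

/-! ### Hook lengths and coefficients -/

/-- `H(b)` for the block `b` of width `w`, relative to the starting row `r₁`:
`H(b) = (w_b - w_{b₁}) + (number of rows in blocks b₁, …, b-1)`. -/
def HW (K : Finset Cell) (r₁ w : ℕ) : ℤ :=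
  ((w : ℤ) - (rowWidth K r₁ : ℤ)) +
    (((rowsOf K).filter fun ρ => rowWidth K r₁ ≤ rowWidth K ρ ∧ rowWidth K ρ < w).card : ℤ)

/-- `H(P)` for a `1`-path with route `R`: the product of `H(b)` over the blocks `b > b₁`
met by the route. -/
def HP1 (K : Finset Cell) (r₁ : ℕ) (R : Finset (BoxOf K)) : ℤ :=
  ∏ w ∈ (R.image fun b => rowWidth K b.val.1).filter (fun w => rowWidth K r₁ < w), HW K r₁ w

/-- The rank (from the bottom, `1`-based) of a route box among the route boxes lying in the
same block. -/
def rankIn (K : Finset Cell) (R : Finset (BoxOf K)) (b : BoxOf K) : ℕ :=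
  (R.filter fun b' => rowWidth K b'.val.1 = rowWidth K b.val.1 ∧ b.val.1 ≤ b'.val.1).card

/-- `H(P)` for an `m`-path with route `R`:
`H(P) = ∏_{b > b₁ met by R} ∏_{i=1}^{k_b} (H(b) - (m - i))`. -/
def HPm (K : Finset Cell) (m : ℕ) (r₁ : ℕ) (R : Finset (BoxOf K)) : ℤ :=
  ∏ b ∈ R.filter fun b => rowWidth K r₁ < rowWidth K b.val.1,
    (HW K r₁ (rowWidth K b.val.1) - (m : ℤ) + (rankIn K R b : ℤ))

/-- The coefficient `(-1)^P / H(P)` of a `1`-path. -/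
def coeff1 (K : Finset Cell) (r₁ : ℕ) (R : Finset (BoxOf K)) : ℂ :=
  (-1 : ℂ) ^ R.card / ((HP1 K r₁ R : ℤ) : ℂ)

/-- The coefficient `(-1)^P / H(P)` of an `m`-path. -/
def coeffm (K : Finset Cell) (m r₁ : ℕ) (R : Finset (BoxOf K)) : ℂ :=
  (-1 : ℂ) ^ R.card / ((HPm K m r₁ R : ℤ) : ℂ)

/-- The subspace `W ⊗ R_{K,n}` of `W ⊗ ℱ_{K,n}`. -/
def tensR (W : Type) [AddCommGroup W] [Module ℂ W] (K : Finset Cell) (n : ℕ) :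
    Submodule ℂ (W ⊗[ℂ] FreeT K n) :=
  Submodule.span ℂ {z | ∃ (a : W) (r : FreeT K n), r ∈ Rmod K n ∧ z = a ⊗ₜ[ℂ] r}

/-! ### Path extensions -/

/-- `B` is a `(ρ, ρ')`-route extension of `R`, where `ρ` is the (geometrically lower) row
with top-index `rlow` and `ρ'` the (higher) row with top-index `rhigh ≤ rlow`: the two
routes agree strictly below `ρ` and strictly above `ρ'`. -/
def RouteExt {K : Finset Cell} (rlow rhigh : ℕ) (R B : Finset (BoxOf K)) : Prop :=
  R.filter (fun b => rlow < b.val.1) = B.filter (fun b => rlow < b.val.1) ∧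
  R.filter (fun b => b.val.1 < rhigh) = B.filter (fun b => b.val.1 < rhigh)

/-- `Q` is a `(ρ, ρ')`-path extension of `P` (rows as in `RouteExt`). -/
def PathExt {K : Finset Cell} {m : ℕ} [NeZero m] {X : RemovalOn K m} (rlow rhigh : ℕ)
    (P Q : MPath X) : Prop :=
  RouteExt rlow rhigh P.route Q.route ∧
  (∀ b ∈ P.route, b.val.1 < rhigh → Q.map (Sum.inl b) = P.map (Sum.inl b)) ∧
  (∀ b ∈ P.route, rlow < b.val.1 →
    ¬(∃ c : BoxOf K, P.map (Sum.inl b) = Sum.inl c ∧ rhigh ≤ c.val.1 ∧ c.val.1 ≤ rlow) →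
    Q.map (Sum.inl b) = P.map (Sum.inl b))

/-! ### Highest weight tableaux and coefficient extraction -/

/-- The highest-weight tableau: every entry in row `r` (from the top, `0`-based) equals
`r + 1` (i.e. the element `r` of `Fin n`). -/
def hwTab (K : Finset Cell) (n : ℕ) (hn : ∀ c ∈ K, c.1 < n) : Tab K n :=
  fun b => ⟨b.val.1, hn _ b.2⟩

/-- The coefficient of the basis vector `e_i ⊗ T₀` of `V ⊗ ℱ_{K',n}`. -/
def coeffAt {K' : Finset Cell} {n : ℕ} (i : Fin n) (T0 : Tab K' n) :
    ((Fin n → ℂ) ⊗[ℂ] FreeT K' n) →ₗ[ℂ] ℂ :=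
  TensorProduct.lift
    (((LinearMap.mul ℂ ℂ).comp (LinearMap.proj i)).compl₂ (Finsupp.lapply T0))

/-- The set of rows met by a route. -/
def rowsMet {K : Finset Cell} (R : Finset (BoxOf K)) : Finset ℕ := R.image fun b => b.val.1

/-! ### Successors in a finite set ordered by an integer rank -/

/-- `w` is the element of `C` of largest rank below the rank of `z`. -/
def IsNext {α : Type*} (C : Set α) (rk : α → ℤ) (z w : α) : Prop :=
  w ∈ C ∧ rk w < rk z ∧ ∀ v ∈ C, rk v < rk z → rk v ≤ rk w

/-- The map sending an element of `C` to the next lower one, if there is any, and fixing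
everything else. -/
def nextIn {α : Type*} (C : Set α) (rk : α → ℤ) (z : α) : α :=
  if h : z ∈ C ∧ ∃ w, IsNext C rk z w then h.2.choose else z

section Next

variable {α : Type*} {C : Set α} {rk : α → ℤ}

lemma IsNext.unique (hinj : Set.InjOn rk C) {z w w' : α} (h : IsNext C rk z w)
    (h' : IsNext C rk z w') : w = w' :=
  hinj h.1 h'.1 (le_antisymm (h'.2.2 w h.1 h.2.1) (h.2.2 w' h'.1 h'.2.1))

lemma nextIn_of_notMem {z : α} (hz : z ∉ C) : nextIn C rk z = z :=
  dif_neg fun h => hz h.1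

lemma nextIn_of_forall_le {z : α} (hz : ∀ w ∈ C, rk z ≤ rk w) : nextIn C rk z = z :=
  dif_neg fun ⟨_, w, hw⟩ => (hz w hw.1).not_gt hw.2.1

lemma isNext_nextIn (hC : C.Finite) {y z : α} (hy : y ∈ C) (hz : z ∈ C) (hyz : rk y < rk z) :
    IsNext C rk z (nextIn C rk z) := by
  have hex : ∃ w, IsNext C rk z w := by
    obtain ⟨w, hw, hmax⟩ := Set.exists_max_image {w | w ∈ C ∧ rk w < rk z} rk
      (hC.subset fun w hw => hw.1) ⟨y, hy, hyz⟩
    exact ⟨w, hw.1, hw.2, fun v hv hlt => hmax v ⟨hv, hlt⟩⟩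
  have h : z ∈ C ∧ ∃ w, IsNext C rk z w := ⟨hz, hex⟩
  rw [nextIn, dif_pos h]
  exact h.2.choose_spec

lemma iterate_nextIn_mem (hC : C.Finite) {x : α} (hx : x ∈ C) (j : ℕ) :
    (nextIn C rk)^[j] x ∈ C := by
  induction j with
  | zero => exact hx
  | succ j ih =>
    rw [Function.iterate_succ_apply']
    generalize (nextIn C rk)^[j] x = z at ih
    by_cases h : ∀ w ∈ C, rk z ≤ rk w
    · rwa [nextIn_of_forall_le h]
    · push Not at h
      obtain ⟨y, hy, hyz⟩ := h
      exact (isNext_nextIn hC hy ih hyz).1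

/-- Starting at an element of maximal rank, iterating `nextIn` visits all of `C`. -/
lemma exists_iterate_nextIn (hC : C.Finite) (hinj : Set.InjOn rk C) {x w : α} (hx : x ∈ C)
    (hmax : ∀ v ∈ C, rk v ≤ rk x) (hw : w ∈ C) : ∃ j : ℕ, (nextIn C rk)^[j] x = w := by
  suffices H : ∀ n : ℕ, ∀ z ∈ C, rk z = rk w + n → ∃ j : ℕ, (nextIn C rk)^[j] z = w from
    H (rk x - rk w).toNat x hx (by have := hmax w hw; omega)
  intro n
  induction n using Nat.strong_induction_on with
  | _ n ih =>
    intro z hz hzw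
    rcases Nat.eq_zero_or_pos n with rfl | hn
    · exact ⟨0, hinj hz hw (by simpa using hzw)⟩
    · have hlt : rk w < rk z := by omega
      obtain ⟨hm, hl, hge⟩ := isNext_nextIn hC hw hz hlt
      have hwn := hge w hw hlt
      obtain ⟨j, hj⟩ := ih (rk (nextIn C rk z) - rk w).toNat (by omega) _ hm (by omega)
      exact ⟨j + 1, by rwa [Function.iterate_succ_apply]⟩

/-- An element of an orbit ending in a fixed point is the starting point or the image of an
element other than the fixed point. -/
lemma iterate_eq_or_exists {f : α → α} {y : α} (hy : f y = y) (x : α) (j : ℕ) :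
    f^[j] x = x ∨ ∃ k, f^[k] x ≠ y ∧ f (f^[k] x) = f^[j] x := by
  induction j with
  | zero => exact Or.inl rfl
  | succ j ih =>
    rw [Function.iterate_succ_apply']
    by_cases h : f^[j] x = y
    · rw [show f (f^[j] x) = f^[j] x by rw [h, hy]]
      exact ih
    · exact Or.inr ⟨j, h, rfl⟩

/-- A map whose orbit of `x` is `C`, and which decreases ranks on `C` away from a fixed
point `y`, sends every other element of `C` to the next one. -/
lemma isNext_of_orbit {f : α → α} {x y z : α} (horb : ∀ w, w ∈ C ↔ ∃ j : ℕ, f^[j] x = w)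
    (hy : f y = y) (hlt : ∀ w ∈ C, w ≠ y → rk (f w) < rk w) (hz : z ∈ C) (hzy : z ≠ y) :
    IsNext C rk z (f z) := by
  have hle : ∀ j, rk (f (f^[j] x)) ≤ rk (f^[j] x) := fun j => by
    by_cases h : f^[j] x = y
    · rw [h, hy]
    · exact (hlt _ ((horb _).2 ⟨j, rfl⟩) h).le
  have hanti : Antitone fun j => rk (f^[j] x) := antitone_nat_of_succ_le fun j => by
    simpa only [Function.iterate_succ_apply'] using hle j
  obtain ⟨j, rfl⟩ := (horb z).1 hz
  refine ⟨(horb _).2 ⟨j + 1, Function.iterate_succ_apply' ..⟩, hlt _ hz hzy, fun v hv hvz => ?_⟩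
  obtain ⟨k, rfl⟩ := (horb v).1 hv
  rw [← Function.iterate_succ_apply' f]
  refine hanti (Nat.succ_le_of_lt ?_)
  by_contra hkj
  exact (hanti (not_lt.1 hkj)).not_gt hvz

end Next

/-! ### The unique `1`-path with a given evacuation route -/

section OnePath

variable {K : Finset Cell} {X : RemovalOn K 1} {R : Finset (BoxOf K)}

/-- The removed box `x₁`, as a box of the extended shape. -/
def startBox (X : RemovalOn K 1) : PB K 1 := Sum.inl ⟨X.box 0, X.mem 0⟩

/-- The set `R ∪ X ∪ Y`. -/
def chainSet (X : RemovalOn K 1) (R : Finset (BoxOf K)) : Set (PB K 1) :=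
  {z | (∃ b ∈ R, z = Sum.inl b) ∨ (∃ i, z = Sum.inl ⟨X.box i, X.mem i⟩) ∨ ∃ i, z = Sum.inr i}

/-- A refinement of twice the row index that puts `x₁` below the rest of its row. -/
def boxRank (X : RemovalOn K 1) (z : PB K 1) : ℤ :=
  2 * lowVal z + if z = startBox X then 1 else 0

lemma mem_chainSet {z : PB K 1} :
    z ∈ chainSet X R ↔ (∃ b ∈ R, z = Sum.inl b) ∨ z = startBox X ∨ z = Sum.inr 0 := by
  simp [chainSet, startBox, Fin.exists_fin_one]

lemma inl_eq_startBox_iff {b : BoxOf K} :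
    (Sum.inl b : PB K 1) = startBox X ↔ b.val = X.box 0 := by
  rw [startBox, Sum.inl.injEq, Subtype.ext_iff]

lemma startBox_mem_chainSet : startBox X ∈ chainSet X R := mem_chainSet.2 (Or.inr (Or.inl rfl))

lemma inr_mem_chainSet : Sum.inr 0 ∈ chainSet X R := mem_chainSet.2 (Or.inr (Or.inr rfl))

lemma inl_mem_chainSet {b : BoxOf K} (hb : b ∈ R) : Sum.inl b ∈ chainSet X R :=
  mem_chainSet.2 (Or.inl ⟨b, hb, rfl⟩)

lemma boxRank_inr : boxRank X (Sum.inr 0) = -2 := by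
  simp [boxRank, startBox, lowVal]

lemma inr_lt_boxRank {z : PB K 1} (hz : z ≠ Sum.inr 0) : boxRank X (Sum.inr 0) < boxRank X z := by
  rw [boxRank_inr]
  rcases z with b | i
  · simp only [boxRank, lowVal]
    split_ifs <;> omega
  · exact absurd (congrArg Sum.inr (Subsingleton.elim i 0)) hz

lemma boxRank_lt_of_lowVal_lt {z w : PB K 1} (h : lowVal z < lowVal w) :
    boxRank X z < boxRank X w := by
  unfold boxRank
  split_ifs <;> omega

lemma lowVal_le_of_boxRank_le {z w : PB K 1} (h : boxRank X z ≤ boxRank X w) :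
    lowVal z ≤ lowVal w :=
  not_lt.1 fun hlt => (boxRank_lt_of_lowVal_lt hlt).not_ge h

lemma chainSet_injOn (hR : ∀ b ∈ R, ∀ b' ∈ R, b.val.1 = b'.val.1 → b = b') :
    Set.InjOn (boxRank X) (chainSet X R) := by
  intro z hz w hw h
  by_cases hzy : z = Sum.inr 0
  · by_contra hne
    subst hzy
    exact (inr_lt_boxRank (Ne.symm hne)).ne h
  by_cases hwy : w = Sum.inr 0
  · subst hwy
    exact absurd h (inr_lt_boxRank hzy).ne'
  by_cases hzx : z = startBox X <;> by_cases hwx : w = startBox X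
  · rw [hzx, hwx]
  · simp only [boxRank, hzx, hwx, if_true, if_false] at h
    omega
  · simp only [boxRank, hzx, hwx, if_true, if_false] at h
    omega
  · obtain ⟨b, hb, rfl⟩ := (mem_chainSet.1 hz).resolve_right (by tauto)
    obtain ⟨c, hc, rfl⟩ := (mem_chainSet.1 hw).resolve_right (by tauto)
    simp only [boxRank, hzx, hwx, if_false, lowVal] at h
    rw [hR b hb c hc (by omega)]

lemma mem_orb_iff {P : PB K 1 → PB K 1} {i : Fin 1} {z : PB K 1} :
    z ∈ orb X P i ↔ ∃ j : ℕ, P^[j] (startBox X) = z := by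
  rw [Subsingleton.elim i 0]
  rfl

namespace IsMPath

variable {P : PB K 1 → PB K 1}

lemma mem_chainSet_iff (h : IsMPath X P R) (z : PB K 1) :
    z ∈ chainSet X R ↔ ∃ j : ℕ, P^[j] (startBox X) = z := by
  rw [show chainSet X R = ⋃ i, orb X P i from h.orb_union.symm]
  simp only [Set.mem_iUnion, mem_orb_iff, exists_const]

lemma row_le (h : IsMPath X P R) : ∀ b ∈ R, b.val.1 ≤ (X.box 0).1 := by
  intro b hb
  obtain ⟨j, hj⟩ := (h.mem_chainSet_iff _).1 (inl_mem_chainSet hb)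
  have hle : ∀ j : ℕ, lowVal (P^[j] (startBox X)) ≤ lowVal (startBox X) := fun j => by
    induction j with
    | zero => exact le_rfl
    | succ j ih =>
      rw [Function.iterate_succ_apply']
      exact (h.mono _).trans ih
  have := hle j
  rw [hj] at this
  exact Int.ofNat_le.1 this

lemma map_startBox_ne (h : IsMPath X P R) : P (startBox X) ≠ startBox X := fun hfix => by
  obtain ⟨j, hj⟩ := mem_orb_iff.1 (h.y_mem 0)
  rw [Function.iterate_fixed hfix] at hj
  exact Sum.inl_ne_inr hj

lemma boxRank_map_lt (h : IsMPath X P R) {z : PB K 1} (hz : z ∈ chainSet X R)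
    (hzy : z ≠ Sum.inr 0) : boxRank X (P z) < boxRank X z := by
  by_cases hzx : z = startBox X
  · subst hzx
    have := h.mono (startBox X)
    simp only [boxRank, h.map_startBox_ne, if_true, if_false]
    omega
  · obtain ⟨b, hb, rfl⟩ := (mem_chainSet.1 hz).resolve_right (by tauto)
    exact boxRank_lt_of_lowVal_lt (h.strict_on_route b hb)

/-- A `1`-path is determined by its evacuation route. -/
lemma eq_nextIn (h : IsMPath X P R) : P = nextIn (chainSet X R) (boxRank X) := by
  funext z
  by_cases hzy : z = Sum.inr 0
  · subst hzy
    rw [h.fix_y, nextIn_of_forall_le]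
    intro w _
    by_cases hw : w = Sum.inr 0
    · rw [hw]
    · exact (inr_lt_boxRank hw).le
  by_cases hz : z ∈ chainSet X R
  · exact (isNext_of_orbit h.mem_chainSet_iff (h.fix_y 0)
      (fun w hw hwy => h.boxRank_map_lt hw hwy) hz hzy).unique
      (chainSet_injOn h.route.one_per_row)
      (isNext_nextIn (Set.toFinite _) inr_mem_chainSet hz (inr_lt_boxRank hzy))
  · rw [nextIn_of_notMem hz]
    rcases z with b | i
    · refine h.fix_out b (fun hb => hz (inl_mem_chainSet hb)) fun i hi => hz ?_
      exact Or.inr (Or.inl ⟨i, congrArg Sum.inl (Subtype.ext hi)⟩)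
    · exact h.fix_y i

end IsMPath

/-- Every evacuation route that does not go below its starting row is the route of a
`1`-path. -/
lemma isMPath_nextIn (hR : IsEvacRoute K (X.box 0).1 R)
    (hrow : ∀ b ∈ R, b.val.1 ≤ (X.box 0).1) :
    IsMPath X (nextIn (chainSet X R) (boxRank X)) R := by
  set P := nextIn (chainSet X R) (boxRank X) with hP
  have hinj : Set.InjOn (boxRank X) (chainSet X R) := chainSet_injOn hR.one_per_row
  have hfin : (chainSet X R).Finite := Set.toFinite _
  have hfixy : P (Sum.inr 0) = Sum.inr 0 := nextIn_of_forall_le fun w _ => by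
    by_cases hw : w = Sum.inr 0
    · rw [hw]
    · exact (inr_lt_boxRank hw).le
  have hnext : ∀ z ∈ chainSet X R, z ≠ Sum.inr 0 →
      IsNext (chainSet X R) (boxRank X) z (P z) := fun z hz hzy =>
    isNext_nextIn hfin inr_mem_chainSet hz (inr_lt_boxRank hzy)
  have hmax : ∀ v ∈ chainSet X R, boxRank X v ≤ boxRank X (startBox X) := by
    intro v hv
    rcases mem_chainSet.1 hv with ⟨b, hb, rfl⟩ | rfl | rfl
    · have := hrow b hb
      simp only [boxRank, if_true]
      simp only [startBox, lowVal]
      split_ifs <;> omega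
    · exact le_rfl
    · exact (inr_lt_boxRank Sum.inl_ne_inr).le
  have horb : ∀ i z, z ∈ orb X P i ↔ z ∈ chainSet X R := fun i z => by
    rw [mem_orb_iff]
    refine ⟨?_, exists_iterate_nextIn hfin hinj startBox_mem_chainSet hmax⟩
    rintro ⟨j, rfl⟩
    exact iterate_nextIn_mem hfin startBox_mem_chainSet j
  have hmono : ∀ z, lowVal (P z) ≤ lowVal z := by
    intro z
    by_cases hzy : z = Sum.inr 0
    · rw [hzy, hfixy]
    by_cases hz : z ∈ chainSet X R
    · exact lowVal_le_of_boxRank_le (hnext z hz hzy).2.1.le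
    · rw [hP, nextIn_of_notMem hz]
  have hne : ∀ z ∈ chainSet X R, z ≠ Sum.inr 0 → P z ≠ startBox X := fun z hz hzy h => by
    have := (hnext z hz hzy).2.1
    rw [h] at this
    exact (hmax z hz).not_gt this
  have hstrict : ∀ b ∈ R, lowVal (P (Sum.inl b)) < (b.val.1 : ℤ) := by
    intro b hb
    obtain ⟨hm, hlt, -⟩ := hnext _ (inl_mem_chainSet hb) Sum.inl_ne_inr
    have hx := hne _ (inl_mem_chainSet hb) Sum.inl_ne_inr
    rcases mem_chainSet.1 hm with ⟨c, hc, hPc⟩ | h | h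
    · rw [hPc] at hlt ⊢
      have hle : c.val.1 ≤ b.val.1 := Int.ofNat_le.1 (lowVal_le_of_boxRank_le hlt.le)
      have hcb : c.val.1 ≠ b.val.1 := fun heq => by
        rw [hR.one_per_row c hc b hb heq] at hlt
        exact hlt.false
      simp only [lowVal]
      omega
    · exact absurd h hx
    · rw [h]
      simp only [lowVal]
      omega
  refine ⟨hR, hmono, hstrict, fun i => ?_, ?_, fun i j hij => absurd (Subsingleton.elim i j) hij,
    ?_, ?_, fun i => ?_, ?_, ?_⟩
  · rw [horb, Subsingleton.elim i 0]
    exact inr_mem_chainSet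
  · ext z
    simp only [Set.mem_iUnion, horb, exists_const]
    rfl
  · intro w _
    refine ⟨fun _ => 0, Set.injOn_of_subsingleton _ _, fun i hi => ?_⟩
    have hroute : ∃ b ∈ R, rowWidth K b.val.1 = w := by
      obtain ⟨c, hc, hcw⟩ := hi
      rcases mem_chainSet.1 ((horb i _).1 hc) with ⟨b, hb, hbc⟩ | h | h
      · rw [Sum.inl.inj hbc] at hcw
        exact ⟨b, hb, hcw⟩
      · obtain ⟨b, hb, hbr⟩ := hR.start
        refine ⟨b, hb, ?_⟩
        rw [hbr, ← hcw, Sum.inl.inj h]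
      · exact absurd h Sum.inl_ne_inr
    refine ⟨(Set.ncard_pos (Set.toFinite _)).2 ⟨i, hi⟩, ?_⟩
    obtain ⟨b₀, hb₀, hw₀⟩ := hroute
    obtain ⟨b, hb, hbmax⟩ := Finset.exists_max_image
      (R.filter fun b => rowWidth K b.val.1 = w) (fun b => b.val.1)
      ⟨b₀, Finset.mem_filter.2 ⟨hb₀, hw₀⟩⟩
    obtain ⟨hbR, hbw⟩ := Finset.mem_filter.1 hb
    refine ⟨b, (horb i _).2 (inl_mem_chainSet hbR), hbw, ?_⟩
    rw [Finset.card_eq_zero, Finset.filter_eq_empty_iff]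
    rintro r - ⟨hlt, hrw⟩
    obtain ⟨b', hb', rfl⟩ := hR.no_skip b hbR r hlt (hrw.trans hbw.symm)
    exact (hbmax b' (Finset.mem_filter.2 ⟨hb', hrw⟩)).not_gt hlt
  · intro b hb b' hb' c c' _ hlt hPb hPb' _ _
    have hc := (hnext _ (inl_mem_chainSet hb) Sum.inl_ne_inr).2.2 (Sum.inl b')
      (inl_mem_chainSet hb') (boxRank_lt_of_lowVal_lt (Int.ofNat_lt.2 hlt))
    have hc' := hstrict b' hb'
    rw [hPb] at hc
    rw [hPb'] at hc'
    exact (Int.ofNat_lt.1 hc').trans_le (Int.ofNat_le.1 (lowVal_le_of_boxRank_le hc))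
  · rw [Subsingleton.elim i 0]
    exact hfixy
  · intro b hb hbX
    refine nextIn_of_notMem fun h => ?_
    rcases mem_chainSet.1 h with ⟨c, hc, hbc⟩ | h | h
    · exact hb (Sum.inl.inj hbc ▸ hc)
    · exact hbX 0 (congrArg Subtype.val (Sum.inl.inj h))
    · exact Sum.inl_ne_inr h
  · have hdom : ∀ b : BoxOf K, (b ∈ R ∨ ∃ i, b.val = X.box i) ↔ Sum.inl b ∈ chainSet X R := by
      intro b
      simp [mem_chainSet, inl_eq_startBox_iff]
    have himg : ∀ z : PB K 1, z ∈ Sum.inl '' {b : BoxOf K | b ∈ R ∧ ∀ i, b.val ≠ X.box i} ∪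
        Set.range (Sum.inr : Fin 1 → PB K 1) ↔ z ∈ chainSet X R ∧ z ≠ startBox X := by
      rintro (b | i)
      · simp [mem_chainSet, inl_eq_startBox_iff]
        tauto
      · simp [mem_chainSet, startBox, Subsingleton.elim i 0]
    ext z
    rw [himg]
    constructor
    · rintro ⟨b, hb, rfl⟩
      have hb' := (hdom b).1 hb
      exact ⟨(hnext _ hb' Sum.inl_ne_inr).1, hne _ hb' Sum.inl_ne_inr⟩
    · rintro ⟨hz, hzx⟩
      obtain ⟨j, rfl⟩ := exists_iterate_nextIn hfin hinj startBox_mem_chainSet hmax hz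
      obtain ⟨k, hky, hk⟩ := (iterate_eq_or_exists hfixy (startBox X) j).resolve_left hzx
      have hkC : P^[k] (startBox X) ∈ chainSet X R :=
        iterate_nextIn_mem hfin startBox_mem_chainSet k
      rw [← hk]
      rcases hPk : P^[k] (startBox X) with b | i
      · rw [hPk] at hkC
        exact ⟨b, (hdom b).2 hkC, rfl⟩
      · exact absurd (hPk.trans (congrArg Sum.inr (Subsingleton.elim i 0))) hky

end OnePath

/-! ### Counting -/

lemma card_rowBoxes (K : Finset Cell) (r : ℕ) : (rowBoxes K r).card = rowWidth K r := by
  refine Finset.card_bij (fun b _ => b.val) (fun b hb => ?_) (fun a _ b _ h => Subtype.ext h)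
    fun c hc => ?_
  · exact Finset.mem_filter.2 ⟨b.2, (Finset.mem_filter.1 hb).2⟩
  · obtain ⟨hcK, hcr⟩ := Finset.mem_filter.1 hc
    exact ⟨⟨c, hcK⟩, Finset.mem_filter.2 ⟨Finset.mem_univ _, hcr⟩, rfl⟩

/-- The set of boxes selected by a choice of one box in each row of `S`. -/
def routeOfChoice {K : Finset Cell} {S : Finset ℕ} (φ : ∀ r ∈ S, BoxOf K) : Finset (BoxOf K) :=
  S.attach.image fun r => φ r.1 r.2

section Choice

variable {K : Finset Cell} {S : Finset ℕ} {φ : ∀ r ∈ S, BoxOf K}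

lemma row_of_mem_pi (hφ : φ ∈ S.pi (rowBoxes K)) {r : ℕ} (hr : r ∈ S) : (φ r hr).val.1 = r :=
  (Finset.mem_filter.1 (Finset.mem_pi.1 hφ r hr)).2

lemma mem_routeOfChoice {b : BoxOf K} :
    b ∈ routeOfChoice φ ↔ ∃ r, ∃ hr : r ∈ S, φ r hr = b := by
  simp [routeOfChoice]

lemma rowsMet_routeOfChoice (hφ : φ ∈ S.pi (rowBoxes K)) : rowsMet (routeOfChoice φ) = S := by
  ext r
  simp only [rowsMet, Finset.mem_image, mem_routeOfChoice]
  constructor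
  · rintro ⟨_, ⟨s, hs, rfl⟩, rfl⟩
    rwa [row_of_mem_pi hφ hs]
  · exact fun hr => ⟨_, ⟨r, hr, rfl⟩, row_of_mem_pi hφ hr⟩

lemma routeOfChoice_one_per_row (hφ : φ ∈ S.pi (rowBoxes K)) :
    ∀ b ∈ routeOfChoice φ, ∀ b' ∈ routeOfChoice φ, b.val.1 = b'.val.1 → b = b' := by
  intro b hb b' hb' h
  obtain ⟨r, hr, rfl⟩ := mem_routeOfChoice.1 hb
  obtain ⟨s, hs, rfl⟩ := mem_routeOfChoice.1 hb'
  rw [row_of_mem_pi hφ, row_of_mem_pi hφ] at h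
  subst h
  rfl

end Choice

lemma mem_rowsMet {K : Finset Cell} {R : Finset (BoxOf K)} {r : ℕ} :
    r ∈ rowsMet R ↔ ∃ b ∈ R, b.val.1 = r := Finset.mem_image

/-- Being an evacuation route depends only on the rows met, as long as these are met once. -/
lemma IsEvacRoute.of_rowsMet_eq {K : Finset Cell} {r₁ : ℕ} {R R' : Finset (BoxOf K)}
    (h : IsEvacRoute K r₁ R) (hrows : rowsMet R' = rowsMet R)
    (hone : ∀ b ∈ R', ∀ b' ∈ R', b.val.1 = b'.val.1 → b = b') : IsEvacRoute K r₁ R' where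
  start := mem_rowsMet.1 (hrows ▸ mem_rowsMet.2 h.start)
  one_per_row := hone
  no_skip b hb r hlt hw := by
    obtain ⟨c, hc, hcb⟩ := mem_rowsMet.1 (hrows ▸ mem_rowsMet.2 ⟨b, hb, rfl⟩)
    rw [← hcb] at hlt hw
    exact mem_rowsMet.1 (hrows ▸ mem_rowsMet.2 (h.no_skip c hc r hlt hw))

/-- Let `S` be the set of rows of `λ` met by the evacuation route of some
`1`-path removing `X`.  Then the number of `1`-paths removing `X` whose evacuation route
meets exactly the rows in `S` equals `∏_{r ∈ S} λ_r`, the product of the widths of those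
rows. -/
theorem statement18 (μ : YoungDiagram) (X : RemovalOn μ.cells 1) (S : Finset ℕ)
    (hS : ∃ P : MPath X, rowsMet P.route = S) :
    (Finset.univ.filter fun P : MPath X => rowsMet P.route = S).card =
      ∏ r ∈ S, rowWidth μ.cells r := by
  obtain ⟨P₀, hP₀⟩ := hS
  have hpath : ∀ φ ∈ S.pi (rowBoxes μ.cells), IsMPath X
      (nextIn (chainSet X (routeOfChoice φ)) (boxRank X)) (routeOfChoice φ) := by
    intro φ hφ
    have hrows := (rowsMet_routeOfChoice hφ).trans hP₀.symm
    refine isMPath_nextIn (P₀.2.route.of_rowsMet_eq hrows (routeOfChoice_one_per_row hφ)) ?_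
    intro b hb
    obtain ⟨c, hc, hcb⟩ := mem_rowsMet.1 (hrows ▸ mem_rowsMet.2 ⟨b, hb, rfl⟩)
    rw [← hcb]
    exact P₀.2.row_le c hc
  simp_rw [← card_rowBoxes]
  rw [← Finset.card_pi]
  symm
  refine Finset.card_bij (fun φ hφ => ⟨(_, routeOfChoice φ), hpath φ hφ⟩) (fun φ hφ => ?_)
    (fun φ hφ ψ hψ h => ?_) fun P hP => ?_
  · exact Finset.mem_filter.2 ⟨Finset.mem_univ _, rowsMet_routeOfChoice hφ⟩
  · have hR : routeOfChoice φ = routeOfChoice ψ := congrArg MPath.route h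
    funext r hr
    refine routeOfChoice_one_per_row hψ _ (hR ▸ mem_routeOfChoice.2 ⟨r, hr, rfl⟩) _
      (mem_routeOfChoice.2 ⟨r, hr, rfl⟩) ?_
    rw [row_of_mem_pi hφ, row_of_mem_pi hψ]
  · have hPS : rowsMet P.route = S := (Finset.mem_filter.1 hP).2
    have hex : ∀ r ∈ S, ∃ b ∈ P.route, b.val.1 = r := fun r hr => mem_rowsMet.1 (hPS ▸ hr)
    choose φ hφR hφrow using hex
    have hφ : φ ∈ S.pi (rowBoxes μ.cells) := Finset.mem_pi.2 fun r hr =>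
      Finset.mem_filter.2 ⟨Finset.mem_univ _, hφrow r hr⟩
    have hR : routeOfChoice φ = P.route := by
      ext b
      rw [mem_routeOfChoice]
      constructor
      · rintro ⟨r, hr, rfl⟩
        exact hφR r hr
      · intro hb
        have hbS : b.val.1 ∈ S := hPS ▸ mem_rowsMet.2 ⟨b, hb, rfl⟩
        exact ⟨_, hbS, P.2.route.one_per_row _ (hφR _ hbS) b hb (hφrow _ hbS)⟩
    refine ⟨φ, hφ, Subtype.ext (Prod.ext ?_ hR)⟩
    change nextIn (chainSet X (routeOfChoice φ)) (boxRank X) = P.val.1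
    rw [hR]
    exact P.2.eq_nextIn.symm

end PieriPaper
end
end

section
/- The number of 1-paths on λ removing X = {x_1 = [b_1](1, w_{b_1})} whose evacuation route is contained in the first column of λ equals h_{b_1} · ∏_{i=b_1+1}^{N} (h_i + 1). -/
/-!
Formalization of definitions from "Pieri inclusions" (arXiv:1911.11045).

Cells `(r, j)` have row index `r` (counted from the *top*, `0`-based; so a cell is
geometrically *lower* than another iff its row index is *larger*) and column index `j`
(`0`-based).  A shape is a finite set `K` of cells; in the intended applications `K` is the
set of cells of a Young diagram (possibly with some boxes removed).  Blocks of a partition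
are recovered as the (automatically contiguous) groups of rows of equal width.
-/

open scoped TensorProduct Classical

noncomputable section

namespace PieriPaper

/-! ### Counting upward closed sets -/

/-- Subsets of `A` that are upward closed in `A`. -/
def upperFamily (A : Finset ℕ) : Finset (Finset ℕ) :=
  A.powerset.filter fun T => ∀ r ∈ T, ∀ r' ∈ A, r < r' → r' ∈ T

lemma card_image_filter_le (A : Finset ℕ) :
    (A.image fun a => A.filter (a ≤ ·)).card = A.card := by
  refine Finset.card_image_of_injOn fun a ha b hb hab => ?_
  have h₁ : a ∈ A.filter (b ≤ ·) := by
    rw [← show A.filter (a ≤ ·) = A.filter (b ≤ ·) from hab]; simpa using ha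
  have h₂ : b ∈ A.filter (a ≤ ·) := by
    rw [show A.filter (a ≤ ·) = A.filter (b ≤ ·) from hab]; simpa using hb
  exact le_antisymm (Finset.mem_filter.1 h₂).2 (Finset.mem_filter.1 h₁).2

lemma upperFamily_eq (A : Finset ℕ) :
    upperFamily A = insert ∅ (A.image fun a => A.filter (a ≤ ·)) := by
  ext T
  simp only [upperFamily, Finset.mem_filter, Finset.mem_powerset, Finset.mem_insert,
    Finset.mem_image]
  constructor
  · rintro ⟨hT, hup⟩
    rcases T.eq_empty_or_nonempty with h | h
    · exact Or.inl h
    · refine Or.inr ⟨T.min' h, hT (T.min'_mem h), ?_⟩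
      ext r
      simp only [Finset.mem_filter]
      refine ⟨fun ⟨hr, hle⟩ => ?_, fun hr => ⟨hT hr, T.min'_le r hr⟩⟩
      rcases hle.eq_or_lt with h' | h'
      · exact h' ▸ T.min'_mem h
      · exact hup _ (T.min'_mem h) r hr h'
  · rintro (rfl | ⟨a, -, rfl⟩)
    · simp
    · refine ⟨Finset.filter_subset _ _, fun r hr r' hr' hlt => ?_⟩
      simp only [Finset.mem_filter] at hr ⊢
      exact ⟨hr', hr.2.trans hlt.le⟩

lemma card_upperFamily (A : Finset ℕ) : (upperFamily A).card = A.card + 1 := by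
  rw [upperFamily_eq, Finset.card_insert_of_notMem, card_image_filter_le]
  simp only [Finset.mem_image, not_exists, not_and]
  intro a ha h
  have : a ∈ A.filter (a ≤ ·) := by simpa using ha
  simp [h] at this

lemma card_upperFamily_mem_max {A : Finset ℕ} {m : ℕ} (hm : m ∈ A) (hmax : ∀ a ∈ A, a ≤ m) :
    ((upperFamily A).filter (m ∈ ·)).card = A.card := by
  rw [upperFamily_eq, Finset.filter_insert, if_neg (by simp), Finset.filter_true_of_mem,
    card_image_filter_le]
  simp only [Finset.mem_image]
  rintro _ ⟨a, ha, rfl⟩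
  exact Finset.mem_filter.2 ⟨hm, hmax a ha⟩

/-- Subsets of `A` containing `m` and upward closed within each fibre of `f`. -/
def blockFamily (f : ℕ → ℕ) (A : Finset ℕ) (m : ℕ) : Finset (Finset ℕ) :=
  A.powerset.filter fun S => m ∈ S ∧ ∀ r ∈ S, ∀ r' ∈ A, r < r' → f r' = f r → r' ∈ S

lemma card_blockFamily_eq_prod (f : ℕ → ℕ) (A : Finset ℕ) {m : ℕ} (hm : m ∈ A) :
    (blockFamily f A m).card = ∏ w ∈ A.image f,
      ((upperFamily (A.filter (f · = w))).filter fun T => w = f m → m ∈ T).card := by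
  rw [← Finset.card_pi]
  refine Finset.card_bij (fun S _ w _ => S.filter (f · = w)) ?_ ?_ ?_
  · intro S hS
    simp only [blockFamily, Finset.mem_filter, Finset.mem_powerset] at hS
    obtain ⟨hSA, hmS, hup⟩ := hS
    simp only [Finset.mem_pi, upperFamily, Finset.mem_filter, Finset.mem_powerset]
    refine fun w _ => ⟨⟨Finset.filter_subset_filter _ hSA, ?_⟩, fun h => ⟨hmS, h.symm⟩⟩
    rintro r ⟨hr, rfl⟩ r' ⟨hr', hf⟩ hlt
    exact ⟨hup r hr r' hr' hlt hf, hf⟩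
  · intro S hS S' hS' h
    simp only [blockFamily, Finset.mem_filter, Finset.mem_powerset] at hS hS'
    have key : ∀ r ∈ A, (r ∈ S ↔ r ∈ S') := fun r hr => by
      have := congrArg (r ∈ ·) (congrFun (congrFun h (f r)) (Finset.mem_image_of_mem f hr))
      simpa using this
    ext r
    exact ⟨fun hr => (key r (hS.1 hr)).1 hr, fun hr => (key r (hS'.1 hr)).2 hr⟩
  · intro p hp
    simp only [Finset.mem_pi, upperFamily, Finset.mem_filter, Finset.mem_powerset] at hp
    refine ⟨A.filter fun r => ∃ h : f r ∈ A.image f, r ∈ p (f r) h, ?_, ?_⟩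
    · simp only [blockFamily, Finset.mem_filter, Finset.mem_powerset]
      have hfm := Finset.mem_image_of_mem f hm
      refine ⟨Finset.filter_subset _ _, ⟨hm, hfm, (hp _ hfm).2 rfl⟩, ?_⟩
      rintro r ⟨hr, hw, hrp⟩ r' hr' hlt hf
      refine ⟨hr', Finset.mem_image_of_mem f hr', ?_⟩
      have := (hp _ hw).1.2 r hrp r' ⟨hr', hf⟩ hlt
      simpa only [hf] using this
    · funext w hw
      ext r
      simp only [Finset.mem_filter]
      constructor
      · rintro ⟨⟨-, _, h⟩, rfl⟩
        exact h
      · intro h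
        obtain ⟨hr, rfl⟩ := Finset.mem_filter.1 ((hp w hw).1.1 h)
        exact ⟨⟨hr, hw, h⟩, rfl⟩

lemma card_blockFamily (f : ℕ → ℕ) (A : Finset ℕ) {m : ℕ} (hm : m ∈ A)
    (hmax : ∀ a ∈ A, a ≤ m) :
    (blockFamily f A m).card = (A.filter (f · = f m)).card *
      ∏ w ∈ (A.image f).erase (f m), ((A.filter (f · = w)).card + 1) := by
  rw [card_blockFamily_eq_prod f A hm,
    ← Finset.mul_prod_erase _ _ (Finset.mem_image_of_mem f hm)]
  congr 1
  · simpa using card_upperFamily_mem_max (A := A.filter (f · = f m)) (by simpa using hm)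
      fun a ha => hmax a (Finset.mem_filter.1 ha).1
  · refine Finset.prod_congr rfl fun w hw => ?_
    rw [Finset.filter_true_of_mem fun T _ h => absurd h (Finset.ne_of_mem_erase hw),
      card_upperFamily]

/-! ### Rows of a Young diagram -/

lemma rowWidth_eq_rowLen (μ : YoungDiagram) (r : ℕ) : rowWidth μ.cells r = μ.rowLen r := by
  rw [YoungDiagram.rowLen_eq_card]
  unfold rowWidth YoungDiagram.row
  congr!

lemma rowWidth_antitone (μ : YoungDiagram) : Antitone (rowWidth μ.cells) := fun a b h => by
  simpa only [rowWidth_eq_rowLen] using μ.rowLen_anti a b h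

lemma mem_cells_iff_lt_rowWidth (μ : YoungDiagram) (c : Cell) :
    c ∈ μ.cells ↔ c.2 < rowWidth μ.cells c.1 := by
  rw [rowWidth_eq_rowLen, ← YoungDiagram.mem_iff_lt_rowLen, YoungDiagram.mem_cells]

lemma mem_rowsOf_iff (μ : YoungDiagram) (r : ℕ) :
    r ∈ rowsOf μ.cells ↔ 0 < rowWidth μ.cells r := by
  simp only [rowsOf, Finset.mem_image]
  constructor
  · rintro ⟨c, hc, rfl⟩
    exact ((Nat.zero_le _).trans_lt ((mem_cells_iff_lt_rowWidth μ c).1 hc))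
  · intro h
    exact ⟨(r, 0), (mem_cells_iff_lt_rowWidth μ (r, 0)).2 h, rfl⟩

lemma RemovalOn.rowWidth_pos {K : Finset Cell} (X : RemovalOn K 1) :
    0 < rowWidth K (X.box 0).1 := by
  have := X.lastCol 0
  omega

/-- The row of the removed box is the lowest row of its block. -/
lemma RemovalOn.le_of_rowWidth_le {μ : YoungDiagram} (X : RemovalOn μ.cells 1) {r : ℕ}
    (h : rowWidth μ.cells (X.box 0).1 ≤ rowWidth μ.cells r) : r ≤ (X.box 0).1 := by
  by_contra! hlt
  have hmem : ((r, (X.box 0).2) : Cell) ∈ μ.cells := by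
    rw [mem_cells_iff_lt_rowWidth]
    have := X.lastCol 0
    simp only
    omega
  have hkept : ((r, (X.box 0).2) : Cell) ∈
      μ.cells.filter fun c => ∀ i : Fin 1, (i : ℕ) < 1 → c ≠ X.box i := by
    refine Finset.mem_filter.2 ⟨hmem, fun i _ h => ?_⟩
    rw [Subsingleton.elim i 0] at h
    have := congrArg Prod.fst h
    simp only at this
    omega
  have := X.lower (a := (r, (X.box 0).2)) (b := X.box 0) ⟨hlt.le, le_rfl⟩ hkept
  exact (Finset.mem_filter.1 this).2 0 zero_lt_one rfl

lemma RemovalOn.rowWidth_le_iff {μ : YoungDiagram} (X : RemovalOn μ.cells 1) {r : ℕ} :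
    rowWidth μ.cells (X.box 0).1 ≤ rowWidth μ.cells r ↔ r ≤ (X.box 0).1 :=
  ⟨X.le_of_rowWidth_le, fun h => rowWidth_antitone μ h⟩

/-- The row sets of the evacuation routes starting at the block of the removed box. -/
def routeRows {μ : YoungDiagram} (X : RemovalOn μ.cells 1) : Finset (Finset ℕ) :=
  blockFamily (rowWidth μ.cells) (Finset.range ((X.box 0).1 + 1)) (X.box 0).1

lemma mem_routeRows {μ : YoungDiagram} (X : RemovalOn μ.cells 1) (S : Finset ℕ) :
    S ∈ routeRows X ↔ (∀ r ∈ S, r ≤ (X.box 0).1) ∧ (X.box 0).1 ∈ S ∧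
      ∀ r ∈ S, ∀ r', r < r' → rowWidth μ.cells r' = rowWidth μ.cells r → r' ∈ S := by
  simp only [routeRows, blockFamily, Finset.mem_filter, Finset.mem_powerset,
    Finset.subset_iff, Finset.mem_range, Nat.lt_succ_iff]
  refine and_congr_right fun hle => and_congr_right fun _ => ?_
  refine forall₂_congr fun r hr => ⟨fun h r' hlt hw => ?_, fun h r' _ => h r'⟩
  exact h r' (X.rowWidth_le_iff.1 (hw ▸ X.rowWidth_le_iff.2 (hle hr))) hlt hw

lemma card_routeRows {μ : YoungDiagram} (X : RemovalOn μ.cells 1) :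
    (routeRows X).card =
      ((rowsOf μ.cells).filter fun ρ =>
          rowWidth μ.cells ρ = rowWidth μ.cells (X.box 0).1).card *
        ∏ w ∈ ((rowsOf μ.cells).image (rowWidth μ.cells)).filter
            (fun w => rowWidth μ.cells (X.box 0).1 < w),
          (((rowsOf μ.cells).filter fun ρ => rowWidth μ.cells ρ = w).card + 1) := by
  have hpos := X.rowWidth_pos
  have hfib : ∀ w, rowWidth μ.cells (X.box 0).1 ≤ w →
      (Finset.range ((X.box 0).1 + 1)).filter (rowWidth μ.cells · = w) =
        (rowsOf μ.cells).filter fun ρ => rowWidth μ.cells ρ = w := by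
    intro w hw
    ext r
    simp only [Finset.mem_filter, Finset.mem_range, Nat.lt_succ_iff, mem_rowsOf_iff,
      ← X.rowWidth_le_iff]
    omega
  have himg : ((Finset.range ((X.box 0).1 + 1)).image (rowWidth μ.cells)).erase
      (rowWidth μ.cells (X.box 0).1) =
      ((rowsOf μ.cells).image (rowWidth μ.cells)).filter
        (fun w => rowWidth μ.cells (X.box 0).1 < w) := by
    ext w
    simp only [Finset.mem_erase, Finset.mem_image, Finset.mem_filter, Finset.mem_range,
      Nat.lt_succ_iff, mem_rowsOf_iff, ← X.rowWidth_le_iff]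
    constructor
    · rintro ⟨hne, r, hr, rfl⟩
      exact ⟨⟨r, by omega, rfl⟩, by omega⟩
    · rintro ⟨⟨r, -, rfl⟩, hlt⟩
      exact ⟨by omega, r, by omega, rfl⟩
  rw [routeRows, card_blockFamily _ _ (by simp) (by simp), himg,
    hfib _ le_rfl]
  congr 1
  exact Finset.prod_congr rfl fun w hw => by rw [hfib w (Finset.mem_filter.1 hw).2.le]

/-! ### A path is determined by its route -/

section Path

variable {K : Finset Cell} {X : RemovalOn K 1} {P : PB K 1 → PB K 1} {R : Finset (BoxOf K)}

/-- The removed box, as a box of `K`. -/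
def RemovalOn.removed (X : RemovalOn K 1) : BoxOf K := ⟨X.box 0, X.mem 0⟩

lemma forall_ne_box_iff (b : BoxOf K) : (∀ i, b.val ≠ X.box i) ↔ b ≠ X.removed := by
  simp [Fin.forall_fin_one, RemovalOn.removed, Subtype.ext_iff]

lemma exists_eq_box_iff (b : BoxOf K) : (∃ i, b.val = X.box i) ↔ b = X.removed := by
  simp [RemovalOn.removed, Subtype.ext_iff]

lemma IsMPath.mem_orb (h : IsMPath X P R) {b : BoxOf K} (hb : b ∈ R) :
    Sum.inl b ∈ orb X P 0 := by
  have : (Sum.inl b : PB K 1) ∈ ⋃ i, orb X P i := by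
    rw [h.orb_union]
    exact Or.inl ⟨b, hb, rfl⟩
  obtain ⟨i, hi⟩ := Set.mem_iUnion.1 this
  rwa [Subsingleton.elim i 0] at hi

lemma IsMPath.lowVal_antitone (h : IsMPath X P R) (z : PB K 1) :
    Antitone fun j => lowVal (P^[j] z) :=
  antitone_nat_of_succ_le fun j => by
    rw [Function.iterate_succ_apply']
    exact h.mono _

lemma IsMPath.row_le_s19 (h : IsMPath X P R) {b : BoxOf K} (hb : b ∈ R) :
    b.val.1 ≤ (X.box 0).1 := by
  obtain ⟨j, hj⟩ := h.mem_orb hb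
  have := h.lowVal_antitone (Sum.inl X.removed) (Nat.zero_le j)
  simp only [RemovalOn.removed, hj, Function.iterate_zero, id] at this
  simpa [lowVal] using this

/-- `P` moves a box to the next box of the route: it does not jump over the route. -/
lemma IsMPath.le_lowVal_apply (h : IsMPath X P R) {b c : BoxOf K}
    (hb : b ∈ R ∨ b = X.removed) (hc : c ∈ R) (hcb : c ≠ b) (hle : c.val.1 ≤ b.val.1)
    (hx : c.val.1 = b.val.1 → b = X.removed) :
    (c.val.1 : ℤ) ≤ lowVal (P (Sum.inl b)) := by
  have hborb : Sum.inl b ∈ orb X P 0 := by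
    rcases hb with hb | rfl
    · exact h.mem_orb hb
    · exact ⟨0, rfl⟩
  obtain ⟨k, hk⟩ := h.mem_orb hc
  rcases hle.eq_or_lt with heq | hlt
  · obtain rfl := hx heq
    cases k with
    | zero => exact absurd (Sum.inl_injective hk).symm hcb
    | succ k =>
      have := h.lowVal_antitone (Sum.inl X.removed) (Nat.le_add_left 1 k)
      simp only [Function.iterate_one] at this
      rwa [show P^[k + 1] (Sum.inl X.removed) = Sum.inl c from hk] at this
  · obtain ⟨j, hj⟩ := hborb
    have hjk : j < k := by
      by_contra! hkj
      have := h.lowVal_antitone (Sum.inl X.removed) hkj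
      simp only [RemovalOn.removed, hj, hk, lowVal] at this
      omega
    have := h.lowVal_antitone (Sum.inl X.removed) (Nat.succ_le_of_lt hjk)
    simp only [RemovalOn.removed, hk, Function.iterate_succ_apply', hj] at this
    exact this

lemma IsMPath.apply_mem (h : IsMPath X P R) {b : BoxOf K} (hb : b ∈ R ∨ b = X.removed) :
    (∃ c ∈ R, c ≠ X.removed ∧ P (Sum.inl b) = Sum.inl c) ∨ P (Sum.inl b) = Sum.inr 0 := by
  have : P (Sum.inl b) ∈ (fun b : BoxOf K => P (Sum.inl b)) ''
      {b : BoxOf K | b ∈ R ∨ ∃ i, b.val = X.box i} :=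
    ⟨b, by simpa only [Set.mem_ofPred_eq, exists_eq_box_iff] using hb, rfl⟩
  rw [h.image_route] at this
  rcases this with ⟨c, ⟨hc, hcx⟩, hP⟩ | ⟨i, hi⟩
  · exact Or.inl ⟨c, hc, (forall_ne_box_iff c).1 hcx, hP.symm⟩
  · exact Or.inr (by rw [← hi, Subsingleton.elim i 0])

lemma IsMPath.lowVal_le {Q : PB K 1 → PB K 1} (hP : IsMPath X P R) (hQ : IsMPath X Q R)
    {b : BoxOf K} (hb : b ∈ R ∨ b = X.removed) :
    lowVal (P (Sum.inl b)) ≤ lowVal (Q (Sum.inl b)) := by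
  rcases hP.apply_mem hb with ⟨c, hc, hcx, hPc⟩ | hPy
  · have hle := hP.mono (Sum.inl b)
    rw [hPc] at hle ⊢
    simp only [lowVal, Nat.cast_le] at hle
    have hlt : b ∈ R → c.val.1 < b.val.1 := fun hbR => by
      have := hP.strict_on_route b hbR
      rw [hPc] at this
      simpa [lowVal] using this
    refine hQ.le_lowVal_apply hb hc ?_ hle fun heq => ?_
    · rintro rfl
      exact (lt_irrefl _) (hlt hc)
    · exact hb.resolve_left fun hbR => (hlt hbR).ne heq
  · rw [hPy]
    rcases hQ.apply_mem hb with ⟨c, -, -, hQc⟩ | hQy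
    · rw [hQc]
      simp only [lowVal, Fin.val_zero]
      omega
    · rw [hQy]

lemma IsMPath.map_unique {Q : PB K 1 → PB K 1} (hP : IsMPath X P R) (hQ : IsMPath X Q R) :
    P = Q := by
  funext z
  rcases z with b | i
  · by_cases hb : b ∈ R ∨ b = X.removed
    · have hval := le_antisymm (hP.lowVal_le hQ hb) (hQ.lowVal_le hP hb)
      rcases hP.apply_mem hb with ⟨c, hc, -, hPc⟩ | hPy <;>
        rcases hQ.apply_mem hb with ⟨d, hd, -, hQd⟩ | hQy
      · rw [hPc, hQd] at hval ⊢
        rw [hP.route.one_per_row c hc d hd (by simpa [lowVal] using hval)]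
      · rw [hPc, hQy] at hval
        simp only [lowVal, Fin.val_zero] at hval
        omega
      · rw [hPy, hQd] at hval
        simp only [lowVal, Fin.val_zero] at hval
        omega
      · rw [hPy, hQy]
    · push Not at hb
      have hbx := (forall_ne_box_iff b).2 hb.2
      rw [hP.fix_out b hb.1 hbx, hQ.fix_out b hb.1 hbx]
  · rw [hP.fix_y, hQ.fix_y]

end Path

/-! ### The path with a prescribed set of rows in the first column -/

section FirstColumn

variable {μ : YoungDiagram} (X : RemovalOn μ.cells 1)

/-- The box of the first column in row `r`, or the extra box if the row is empty. -/
def colBox (μ : YoungDiagram) (r : ℕ) : PB μ.cells 1 :=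
  if h : (r, 0) ∈ μ.cells then Sum.inl ⟨(r, 0), h⟩ else Sum.inr 0

/-- The first column box in the first row of `S` strictly above row `r`, or the extra box if
there is none. -/
def nextBox (μ : YoungDiagram) (S : Finset ℕ) (r : ℕ) : PB μ.cells 1 :=
  if h : (S.filter (· < r)).Nonempty then colBox μ ((S.filter (· < r)).max' h) else Sum.inr 0

/-- The route in the first column with row set `S`. -/
def colRoute (μ : YoungDiagram) (S : Finset ℕ) : Finset (BoxOf μ.cells) :=
  Finset.univ.filter fun b => b.val.2 = 0 ∧ b.val.1 ∈ S

/-- The map of boxes of the path in the first column with row set `S`. -/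
def colMap (S : Finset ℕ) : PB μ.cells 1 → PB μ.cells 1
  | Sum.inl b =>
    if b ∈ colRoute μ S then nextBox μ S b.val.1
    else if b = X.removed then colBox μ b.val.1 else Sum.inl b
  | Sum.inr i => Sum.inr i

variable {X} {S : Finset ℕ}

lemma mem_colRoute {b : BoxOf μ.cells} : b ∈ colRoute μ S ↔ b.val.2 = 0 ∧ b.val.1 ∈ S := by
  simp [colRoute]

lemma mem_firstCol (hS : S ∈ routeRows X) {r : ℕ} (hr : r ∈ S) : (r, 0) ∈ μ.cells := by
  rw [mem_cells_iff_lt_rowWidth]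
  exact X.rowWidth_pos.trans_le (X.rowWidth_le_iff.2 (((mem_routeRows X S).1 hS).1 r hr))

lemma colBox_of_mem {r : ℕ} (h : (r, 0) ∈ μ.cells) : colBox μ r = Sum.inl ⟨(r, 0), h⟩ :=
  dif_pos h

lemma colBox_fst {b : BoxOf μ.cells} (h : b.val.2 = 0) : colBox μ b.val.1 = Sum.inl b := by
  obtain ⟨⟨r, j⟩, hb⟩ := b
  obtain rfl : j = 0 := h
  exact colBox_of_mem hb

/-- Either the next box lies on the route, with no row of `S` in between, or no row of `S` is
left. -/
lemma nextBox_cases (hS : S ∈ routeRows X) (r : ℕ) :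
    (∃ c ∈ colRoute μ S, nextBox μ S r = Sum.inl c ∧ c.val.1 < r ∧
      ∀ s ∈ S, s < r → s ≤ c.val.1) ∨
    (nextBox μ S r = Sum.inr 0 ∧ ∀ s ∈ S, ¬ s < r) := by
  by_cases h : (S.filter (· < r)).Nonempty
  · have hmem := Finset.mem_filter.1 ((S.filter (· < r)).max'_mem h)
    refine Or.inl ⟨⟨(_, 0), mem_firstCol hS hmem.1⟩, mem_colRoute.2 ⟨rfl, hmem.1⟩, ?_, hmem.2,
      fun s hs hlt => Finset.le_max' _ s (Finset.mem_filter.2 ⟨hs, hlt⟩)⟩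
    rw [nextBox, dif_pos h, colBox_of_mem (mem_firstCol hS hmem.1)]
  · refine Or.inr ⟨dif_neg h, fun s hs hlt => h ⟨s, Finset.mem_filter.2 ⟨hs, hlt⟩⟩⟩

lemma colMap_of_mem {b : BoxOf μ.cells} (hb : b ∈ colRoute μ S) :
    colMap X S (Sum.inl b) = nextBox μ S b.val.1 := if_pos hb

lemma colMap_removed (hx : X.removed ∉ colRoute μ S) :
    colMap X S (Sum.inl X.removed) = colBox μ (X.box 0).1 :=
  (if_neg hx).trans (if_pos rfl)

lemma colMap_of_notMem {b : BoxOf μ.cells} (hb : b ∉ colRoute μ S) (hx : b ≠ X.removed) :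
    colMap X S (Sum.inl b) = Sum.inl b := by
  simp [colMap, hb, hx]

/-- The box of the route in the row of the removed box. -/
lemma exists_start (hS : S ∈ routeRows X) :
    ∃ b ∈ colRoute μ S, b.val.1 = (X.box 0).1 ∧ colBox μ (X.box 0).1 = Sum.inl b := by
  have hr := ((mem_routeRows X S).1 hS).2.1
  exact ⟨⟨((X.box 0).1, 0), mem_firstCol hS hr⟩, mem_colRoute.2 ⟨rfl, hr⟩, rfl,
    colBox_of_mem _⟩

/-- On the route and the removed box, `colMap` takes values in the rest of the route, or is the
extra box. -/
lemma colMap_mem (hS : S ∈ routeRows X) {b : BoxOf μ.cells}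
    (hb : b ∈ colRoute μ S ∨ b = X.removed) :
    (∃ c ∈ colRoute μ S, c ≠ X.removed ∧ colMap X S (Sum.inl b) = Sum.inl c) ∨
      colMap X S (Sum.inl b) = Sum.inr 0 := by
  by_cases hbR : b ∈ colRoute μ S
  · rw [colMap_of_mem hbR]
    rcases nextBox_cases hS b.val.1 with ⟨c, hc, hn, hlt, -⟩ | ⟨hn, -⟩
    · refine Or.inl ⟨c, hc, ?_, hn⟩
      rintro rfl
      exact absurd (((mem_routeRows X S).1 hS).1 _ (mem_colRoute.1 hbR).2) (not_le.2 hlt)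
    · exact Or.inr hn
  · obtain rfl := hb.resolve_left hbR
    obtain ⟨c, hc, -, hcol⟩ := exists_start hS
    refine Or.inl ⟨c, hc, ?_, (colMap_removed hbR).trans hcol⟩
    rintro rfl
    exact hbR hc

lemma lowVal_colMap_lt (hS : S ∈ routeRows X) {b : BoxOf μ.cells} (hb : b ∈ colRoute μ S) :
    lowVal (colMap X S (Sum.inl b)) < (b.val.1 : ℤ) := by
  rw [colMap_of_mem hb]
  rcases nextBox_cases hS b.val.1 with ⟨c, -, hn, hlt, -⟩ | ⟨hn, -⟩
  · rw [hn]
    simpa [lowVal] using hlt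
  · rw [hn]
    simp only [lowVal, Fin.val_zero]
    omega

lemma lowVal_colMap_le (hS : S ∈ routeRows X) (z : PB μ.cells 1) :
    lowVal (colMap X S z) ≤ lowVal z := by
  rcases z with b | i
  · by_cases hb : b ∈ colRoute μ S
    · exact (lowVal_colMap_lt hS hb).le
    · by_cases hx : b = X.removed
      · subst hx
        obtain ⟨c, -, hrow, hcol⟩ := exists_start hS
        rw [colMap_removed hb, hcol]
        simp [lowVal, hrow, RemovalOn.removed]
      · rw [colMap_of_notMem hb hx]
  · exact le_rfl

lemma orb_step {P : PB μ.cells 1 → PB μ.cells 1} {z : PB μ.cells 1} (hz : z ∈ orb X P 0) :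
    P z ∈ orb X P 0 := by
  obtain ⟨j, rfl⟩ := hz
  exact ⟨j + 1, Function.iterate_succ_apply' _ _ _⟩

lemma mem_orb_colMap (hS : S ∈ routeRows X) {b : BoxOf μ.cells} (hb : b ∈ colRoute μ S) :
    Sum.inl b ∈ orb X (colMap X S) 0 := by
  obtain ⟨hle, -, -⟩ := (mem_routeRows X S).1 hS
  induction hn : (X.box 0).1 - b.val.1 using Nat.strong_induction_on generalizing b with
  | _ n ih =>
    have hb' := mem_colRoute.1 hb
    rcases (hle _ hb'.2).eq_or_lt with heq | hlt
    · by_cases hx : X.removed ∈ colRoute μ S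
      · have : b = X.removed := Subtype.ext (Prod.ext heq (hb'.1.trans (mem_colRoute.1 hx).1.symm))
        exact ⟨0, congrArg Sum.inl this.symm⟩
      · refine ⟨1, ?_⟩
        rw [Function.iterate_one]
        refine (colMap_removed hx).trans ?_
        rw [← heq, colBox_fst hb'.1]
    · have hne : (S.filter (b.val.1 < ·)).Nonempty :=
        ⟨_, Finset.mem_filter.2 ⟨((mem_routeRows X S).1 hS).2.1, hlt⟩⟩
      set t := (S.filter (b.val.1 < ·)).min' hne
      have ht := Finset.mem_filter.1 ((S.filter (b.val.1 < ·)).min'_mem hne)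
      have hmin : ∀ s ∈ S, b.val.1 < s → t ≤ s := fun s hs h =>
        Finset.min'_le _ s (Finset.mem_filter.2 ⟨hs, h⟩)
      have htle := hle t ht.1
      have hbt : b.val.1 < t := ht.2
      have htR : (⟨(t, 0), mem_firstCol hS ht.1⟩ : BoxOf μ.cells) ∈ colRoute μ S :=
        mem_colRoute.2 ⟨rfl, ht.1⟩
      have horb := orb_step (ih ((X.box 0).1 - t) (by omega) htR rfl)
      rw [colMap_of_mem htR] at horb
      rcases nextBox_cases hS t with ⟨c, hc, hnext, hct, hmax⟩ | ⟨-, hno⟩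
      · have hc' := mem_colRoute.1 hc
        have h₁ := hmax _ hb'.2 hbt
        have h₂ : ¬ b.val.1 < c.val.1 := fun h => absurd (hmin _ hc'.2 h) (not_le.2 hct)
        have : b = c := Subtype.ext (Prod.ext (by omega) (hb'.1.trans hc'.1.symm))
        rw [this, ← hnext]
        exact horb
      · exact absurd hbt (hno _ hb'.2)

lemma exists_colMap_eq_extra (hS : S ∈ routeRows X) :
    ∃ b ∈ colRoute μ S, colMap X S (Sum.inl b) = Sum.inr 0 := by
  have hne : S.Nonempty := ⟨_, ((mem_routeRows X S).1 hS).2.1⟩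
  have hb : (⟨(S.min' hne, 0), mem_firstCol hS (S.min'_mem hne)⟩ : BoxOf μ.cells) ∈
      colRoute μ S := mem_colRoute.2 ⟨rfl, S.min'_mem hne⟩
  refine ⟨_, hb, ?_⟩
  rw [colMap_of_mem hb]
  rcases nextBox_cases hS (S.min' hne) with ⟨c, hc, -, hlt, -⟩ | ⟨hn, -⟩
  · exact absurd (S.min'_le _ (mem_colRoute.1 hc).2) (not_le.2 hlt)
  · exact hn

lemma orb_colMap (hS : S ∈ routeRows X) :
    orb X (colMap X S) 0 =
      {z | (∃ b, (b ∈ colRoute μ S ∨ b = X.removed) ∧ z = Sum.inl b) ∨ z = Sum.inr 0} := by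
  ext z
  constructor
  · rintro ⟨j, rfl⟩
    induction j with
    | zero => exact Or.inl ⟨X.removed, Or.inr rfl, rfl⟩
    | succ j ih =>
      rw [Function.iterate_succ_apply']
      rcases ih with ⟨b, hb, hz⟩ | hz
      · rw [hz]
        rcases colMap_mem hS hb with ⟨c, hc, -, h⟩ | h
        · exact Or.inl ⟨c, Or.inl hc, h⟩
        · exact Or.inr h
      · rw [hz]
        exact Or.inr rfl
  · rintro (⟨b, hb | rfl, rfl⟩ | rfl)
    · exact mem_orb_colMap hS hb
    · exact ⟨0, rfl⟩
    · obtain ⟨b, hb, h⟩ := exists_colMap_eq_extra hS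
      exact h ▸ orb_step (mem_orb_colMap hS hb)

lemma isEvacRoute_colRoute (hS : S ∈ routeRows X) :
    IsEvacRoute μ.cells (X.box 0).1 (colRoute μ S) where
  start := by
    obtain ⟨b, hb, hrow, -⟩ := exists_start hS
    exact ⟨b, hb, hrow⟩
  one_per_row b hb b' hb' h :=
    Subtype.ext (Prod.ext h ((mem_colRoute.1 hb).1.trans (mem_colRoute.1 hb').1.symm))
  no_skip b hb r hlt hw := by
    have hr := ((mem_routeRows X S).1 hS).2.2 _ (mem_colRoute.1 hb).2 r hlt hw
    exact ⟨⟨(r, 0), mem_firstCol hS hr⟩, mem_colRoute.2 ⟨rfl, hr⟩, rfl⟩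

lemma image_colMap (hS : S ∈ routeRows X) :
    (fun b : BoxOf μ.cells => colMap X S (Sum.inl b)) ''
        {b | b ∈ colRoute μ S ∨ b = X.removed} =
      Sum.inl '' {b : BoxOf μ.cells | b ∈ colRoute μ S ∧ b ≠ X.removed} ∪
        Set.range (Sum.inr : Fin 1 → PB μ.cells 1) := by
  ext z
  constructor
  · rintro ⟨b, hb, rfl⟩
    rcases colMap_mem hS hb with ⟨c, hc, hcx, h⟩ | h
    · exact Or.inl ⟨c, ⟨hc, hcx⟩, h.symm⟩
    · exact Or.inr ⟨0, h.symm⟩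
  · rintro (⟨c, ⟨hc, hcx⟩, rfl⟩ | ⟨i, rfl⟩)
    · obtain ⟨j, hj⟩ := mem_orb_colMap hS hc
      cases j with
      | zero => exact absurd (Sum.inl_injective hj).symm hcx
      | succ j =>
        rw [Function.iterate_succ_apply'] at hj
        have hmem : (colMap X S)^[j] (Sum.inl X.removed) ∈ orb X (colMap X S) 0 := ⟨j, rfl⟩
        rw [orb_colMap hS] at hmem
        rcases hmem with ⟨b, hb, hz⟩ | hz
        · refine ⟨b, hb, ?_⟩
          simp only [← hz]
          exact hj
        · rw [show (colMap X S)^[j] (Sum.inl ⟨X.box 0, X.mem 0⟩) = Sum.inr 0 from hz] at hj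
          exact absurd hj Sum.inr_ne_inl
    · obtain ⟨b, hb, h⟩ := exists_colMap_eq_extra hS
      exact ⟨b, Or.inl hb, by rw [Subsingleton.elim i 0]; exact h⟩

lemma exists_lowest_row (hS : S ∈ routeRows X) {w : ℕ}
    (h : ∃ s ∈ S, rowWidth μ.cells s = w) :
    ∃ c ∈ colRoute μ S, rowWidth μ.cells c.val.1 = w ∧
      (rowsOf μ.cells).filter (fun r => c.val.1 < r ∧ rowWidth μ.cells r = w) = ∅ := by
  obtain ⟨s, hs, hw⟩ := h
  have hne : (S.filter (rowWidth μ.cells · = w)).Nonempty :=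
    ⟨s, Finset.mem_filter.2 ⟨hs, hw⟩⟩
  have ht := Finset.mem_filter.1 (Finset.max'_mem _ hne)
  refine ⟨⟨(_, 0), mem_firstCol hS ht.1⟩, mem_colRoute.2 ⟨rfl, ht.1⟩, ht.2, ?_⟩
  refine Finset.filter_eq_empty_iff.2 fun r _ ⟨hlt, hr⟩ => ?_
  have hrS := ((mem_routeRows X S).1 hS).2.2 _ ht.1 r hlt (hr.trans ht.2.symm)
  exact absurd (Finset.le_max' _ r (Finset.mem_filter.2 ⟨hrS, hr⟩)) (not_le.2 hlt)

lemma isMPath_colMap (hS : S ∈ routeRows X) : IsMPath X (colMap X S) (colRoute μ S) where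
  route := isEvacRoute_colRoute hS
  mono := lowVal_colMap_le hS
  strict_on_route _ hb := lowVal_colMap_lt hS hb
  y_mem i := by
    rw [Subsingleton.elim i 0, orb_colMap hS]
    exact Or.inr rfl
  orb_union := by
    rw [show (⋃ i, orb X (colMap X S) i) = orb X (colMap X S) 0 by ext z; simp, orb_colMap hS]
    ext z
    simp only [Set.mem_ofPred_eq, or_and_right, exists_or, exists_eq_left, Fin.exists_fin_one,
      or_assoc]
    rfl
  orb_disjoint i j hij := absurd (Subsingleton.elim i j) hij
  interlace w _ := by
    refine ⟨fun _ => 0, fun i _ j _ _ => Subsingleton.elim i j, fun i hi => ⟨?_, ?_⟩⟩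
    · exact (Set.ncard_pos (Set.toFinite _)).2 ⟨i, hi⟩
    · obtain ⟨c, hc, hcw⟩ := hi
      rw [Subsingleton.elim i 0] at hc ⊢
      have hex : ∃ s ∈ S, rowWidth μ.cells s = w := by
        rw [orb_colMap hS] at hc
        rcases hc with ⟨b, hb, hz⟩ | hz
        · obtain rfl := Sum.inl_injective hz
          refine ⟨c.val.1, ?_, hcw⟩
          rcases hb with hb | rfl
          · exact (mem_colRoute.1 hb).2
          · exact ((mem_routeRows X S).1 hS).2.1
        · exact absurd hz Sum.inl_ne_inr
      obtain ⟨d, hd, hdw, hcard⟩ := exists_lowest_row hS hex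
      exact ⟨d, mem_orb_colMap hS hd, hdw, Finset.card_eq_zero.2 hcard⟩
  row_order b hb b' hb' c c' _ hlt hc hc' _ _ := by
    have hlow := lowVal_colMap_lt hS hb'
    rw [hc'] at hlow
    simp only [lowVal, Nat.cast_lt] at hlow
    rw [colMap_of_mem hb] at hc
    rcases nextBox_cases hS b.val.1 with ⟨d, -, hn, -, hmax⟩ | ⟨hn, -⟩
    · obtain rfl := Sum.inl_injective (hn.symm.trans hc)
      exact hlow.trans_le (hmax _ (mem_colRoute.1 hb').2 hlt)
    · exact absurd (hn.symm.trans hc) Sum.inr_ne_inl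
  fix_y _ := rfl
  fix_out b hb hx := colMap_of_notMem hb ((forall_ne_box_iff b).1 hx)
  image_route := by
    simp only [exists_eq_box_iff, forall_ne_box_iff]
    exact image_colMap hS

lemma IsMPath.image_row_mem {P : PB μ.cells 1 → PB μ.cells 1} {R : Finset (BoxOf μ.cells)}
    (h : IsMPath X P R) : (R.image fun b => b.val.1) ∈ routeRows X := by
  simp only [mem_routeRows, Finset.mem_image]
  refine ⟨?_, h.route.start, ?_⟩
  · rintro _ ⟨b, hb, rfl⟩
    exact h.row_le_s19 hb
  · rintro _ ⟨b, hb, rfl⟩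
    exact h.route.no_skip b hb

lemma eq_colRoute {R : Finset (BoxOf μ.cells)} (h : ∀ b ∈ R, b.val.2 = 0) :
    R = colRoute μ (R.image fun b => b.val.1) := by
  ext b
  simp only [mem_colRoute, Finset.mem_image]
  refine ⟨fun hb => ⟨h b hb, b, hb, rfl⟩, ?_⟩
  rintro ⟨hb, c, hc, hrow⟩
  rwa [← show c = b from Subtype.ext (Prod.ext hrow ((h c hc).trans hb.symm))]

lemma image_row_colRoute (hS : S ∈ routeRows X) :
    ((colRoute μ S).image fun b => b.val.1) = S := by
  ext r
  simp only [Finset.mem_image, mem_colRoute]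
  constructor
  · rintro ⟨b, ⟨-, hb⟩, rfl⟩
    exact hb
  · exact fun hr => ⟨⟨(r, 0), mem_firstCol hS hr⟩, ⟨rfl, hr⟩, rfl⟩

lemma card_firstCol_paths (X : RemovalOn μ.cells 1) :
    (Finset.univ.filter fun P : MPath X => ∀ b ∈ P.route, b.val.2 = 0).card =
      (routeRows X).card := by
  refine Finset.card_bij (fun P _ => P.route.image fun b => b.val.1)
    (fun P _ => IsMPath.image_row_mem P.2) ?_ ?_
  · intro P hP Q hQ h
    have hroute : P.route = Q.route := by
      rw [eq_colRoute (Finset.mem_filter.1 hP).2, eq_colRoute (Finset.mem_filter.1 hQ).2]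
      exact congrArg _ h
    have hQ' : IsMPath X Q.map P.route := hroute ▸ Q.2
    exact Subtype.ext (Prod.ext (IsMPath.map_unique P.2 hQ') hroute)
  · intro S hS
    refine ⟨⟨(colMap X S, colRoute μ S), isMPath_colMap hS⟩, ?_, image_row_colRoute hS⟩
    exact Finset.mem_filter.2 ⟨Finset.mem_univ _, fun b hb => (mem_colRoute.1 hb).1⟩

end FirstColumn

/-- The number of `1`-paths removing `X` whose evacuation route is
contained in the first column of `λ` equals `h_{b₁} · ∏_{b > b₁} (h_b + 1)`: here
`h_{b₁}` is the number of rows of the block of the removed box (the rows of width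
`w_{b₁} = rowWidth μ (X.box 0).1`), and the product runs over the widths `w > w_{b₁}` of
the blocks above it, `h_b` being the number of rows of width `w`. -/
theorem statement19 (μ : YoungDiagram) (X : RemovalOn μ.cells 1) :
    (Finset.univ.filter fun P : MPath X => ∀ b ∈ P.route, b.val.2 = 0).card =
      ((rowsOf μ.cells).filter fun ρ =>
          rowWidth μ.cells ρ = rowWidth μ.cells (X.box 0).1).card *
        ∏ w ∈ ((rowsOf μ.cells).image (rowWidth μ.cells)).filter
            (fun w => rowWidth μ.cells (X.box 0).1 < w),
          (((rowsOf μ.cells).filter fun ρ => rowWidth μ.cells ρ = w).card + 1) := by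
  rw [card_firstCol_paths, card_routeRows]

end PieriPaper
end
end
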